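/- Weighted weak (2,2) bound for the directional maximal operator with N uniformly spread directions: there is an absolute constant C such that for N > 10, any weight w on ℝ², and W = M_{Σ_N} M_Q w, sup_{t>0} t · w({x ∈ ℝ² : M_{Σ_N} f(x) > t})^{1/2} ≤ C (log N)^{1/2} ‖f‖_{L²(ℝ², W)} for all f ∈ L²(ℝ², W). -/

import Mathlib

open MeasureTheory Set Real
open scoped ENNReal

noncomputable section

/-- A cube (square) in the plane with sides parallel to the axes. -/
def IsCube2 (Q : Set (ℝ × ℝ)) : Prop :=
  ∃ a b r : ℝ, 0 < r ∧ Q = Ioo a (a + r) ×ˢ Ioo b (b + r)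

/-- The Hardy–Littlewood maximal operator over cubes in the plane. -/
def MHL2 (f : ℝ × ℝ → ℝ) (x : ℝ × ℝ) : ℝ≥0∞ :=
  ⨆ (Q : Set (ℝ × ℝ)) (_ : IsCube2 Q ∧ x ∈ Q),
    (∫⁻ y in Q, ENNReal.ofReal |f y|) / volume Q

/-- The open rectangle with center `c`, long direction `v`, short side `l` and
long side `L`. -/
def dirRect (v c : ℝ × ℝ) (l L : ℝ) : Set (ℝ × ℝ) :=
  {x | |(x.1 - c.1) * v.1 + (x.2 - c.2) * v.2| < L / 2 ∧
       |(x.2 - c.2) * v.1 - (x.1 - c.1) * v.2| < l / 2}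

/-- The set of `N` uniformly spread unit vectors on the circle. -/
def SigmaN (N : ℕ) : Set (ℝ × ℝ) :=
  {v | ∃ j < N, v = (Real.cos (2 * π * j / N), Real.sin (2 * π * j / N))}

/-- Rectangles whose longest side is parallel to a direction in `Σ_N`. -/
def IsDirRect (N : ℕ) (R : Set (ℝ × ℝ)) : Prop :=
  ∃ v ∈ SigmaN N, ∃ c : ℝ × ℝ, ∃ l L : ℝ, 0 < l ∧ l ≤ L ∧ R = dirRect v c l L

/-- The directional maximal operator associated with `Σ_N`. -/
def MSig (N : ℕ) (f : ℝ × ℝ → ℝ) (x : ℝ × ℝ) : ℝ≥0∞ :=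
  ⨆ (R : Set (ℝ × ℝ)) (_ : IsDirRect N R ∧ x ∈ R),
    (∫⁻ y in R, ENNReal.ofReal |f y|) / volume R

/-- The directional maximal operator acting on `ℝ≥0∞`-valued functions. -/
def MSigE (N : ℕ) (g : ℝ × ℝ → ℝ≥0∞) (x : ℝ × ℝ) : ℝ≥0∞ :=
  ⨆ (R : Set (ℝ × ℝ)) (_ : IsDirRect N R ∧ x ∈ R),
    (∫⁻ y in R, g y) / volume R

lemma abs_le_one_of_sq_add_sq {a b : ℝ} (h : a ^ 2 + b ^ 2 = 1) : |a| ≤ 1 := by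
  rw [← sq_le_one_iff_abs_le_one]
  linarith [sq_nonneg b]

/-- The area of a parallelogram cut out by two strips. -/
lemma volume_strip_inter_strip (p q : ℝ × ℝ) (a b A B : ℝ) (hD : p.1 * q.2 - p.2 * q.1 ≠ 0)
    (hA : 0 ≤ A) :
    volume {x : ℝ × ℝ | |p.1 * x.1 + p.2 * x.2 - a| < A / 2 ∧
      |q.1 * x.1 + q.2 * x.2 - b| < B / 2} =
      ENNReal.ofReal (A * B / |p.1 * q.2 - p.2 * q.1|) := by
  have hdet : LinearMap.det (Matrix.toLin (Module.Basis.finTwoProd ℝ) (Module.Basis.finTwoProd ℝ)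
      !![p.1, p.2; q.1, q.2]) = p.1 * q.2 - p.2 * q.1 := by
    rw [LinearMap.det_toLin, Matrix.det_fin_two_of]
  have hset : {x : ℝ × ℝ | |p.1 * x.1 + p.2 * x.2 - a| < A / 2 ∧
      |q.1 * x.1 + q.2 * x.2 - b| < B / 2} =
      Matrix.toLin (Module.Basis.finTwoProd ℝ) (Module.Basis.finTwoProd ℝ)
        !![p.1, p.2; q.1, q.2] ⁻¹'
        (Ioo (a - A / 2) (a + A / 2) ×ˢ Ioo (b - B / 2) (b + B / 2)) := by
    ext x
    simp only [mem_ofPred_eq, mem_preimage, Matrix.toLin_finTwoProd_apply, mem_prod, mem_Ioo,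
      abs_lt]
    constructor <;> rintro ⟨⟨h1, h2⟩, h3, h4⟩ <;> refine ⟨⟨?_, ?_⟩, ?_, ?_⟩ <;> linarith
  rw [hset, Measure.addHaar_preimage_linearMap _ (by rwa [hdet]), hdet, Measure.volume_eq_prod,
    Measure.prod_prod, Real.volume_Ioo, Real.volume_Ioo,
    show a + A / 2 - (a - A / 2) = A by ring, show b + B / 2 - (b - B / 2) = B by ring,
    ← ENNReal.ofReal_mul hA, ← ENNReal.ofReal_mul (abs_nonneg _), abs_inv]
  congr 1
  ring

lemma volume_dirRect {v : ℝ × ℝ} (hv : v.1 ^ 2 + v.2 ^ 2 = 1) (c : ℝ × ℝ) {l L : ℝ}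
    (hL : 0 ≤ L) : volume (dirRect v c l L) = ENNReal.ofReal (l * L) := by
  have h := volume_strip_inter_strip v (-v.2, v.1) (v.1 * c.1 + v.2 * c.2)
    (-v.2 * c.1 + v.1 * c.2) L l (by simp only; nlinarith) hL
  have hD : |v.1 * v.1 - v.2 * -v.2| = 1 := by
    rw [show v.1 * v.1 - v.2 * -v.2 = 1 by nlinarith, abs_one]
  simp only [hD, div_one] at h
  rw [mul_comm l L, ← h]
  congr 1
  ext x
  simp only [dirRect, mem_ofPred_eq]
  rw [show (x.1 - c.1) * v.1 + (x.2 - c.2) * v.2 =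
      v.1 * x.1 + v.2 * x.2 - (v.1 * c.1 + v.2 * c.2) by ring,
    show (x.2 - c.2) * v.1 - (x.1 - c.1) * v.2 =
      -v.2 * x.1 + v.1 * x.2 - (-v.2 * c.1 + v.1 * c.2) by ring]

lemma isOpen_dirRect (v c : ℝ × ℝ) (l L : ℝ) : IsOpen (dirRect v c l L) := by
  have h1 : Continuous fun x : ℝ × ℝ => |(x.1 - c.1) * v.1 + (x.2 - c.2) * v.2| := by fun_prop
  have h2 : Continuous fun x : ℝ × ℝ => |(x.2 - c.2) * v.1 - (x.1 - c.1) * v.2| := by fun_prop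
  exact (isOpen_lt h1 continuous_const).inter (isOpen_lt h2 continuous_const)

lemma volume_dirRect_inter_le_of_sin {v u : ℝ × ℝ} (c d : ℝ × ℝ) {l L m M : ℝ} (hl : 0 ≤ l)
    (hs : u.1 * v.2 - u.2 * v.1 ≠ 0) :
    volume (dirRect v c l L ∩ dirRect u d m M) ≤
      ENNReal.ofReal (l * m / |u.1 * v.2 - u.2 * v.1|) := by
  have h := volume_strip_inter_strip (-v.2, v.1) (-u.2, u.1) (-v.2 * c.1 + v.1 * c.2)
    (-u.2 * d.1 + u.1 * d.2) l m
    (by simp only; intro h; apply hs; linarith) hl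
  have hD : |-v.2 * u.1 - v.1 * -u.2| = |u.1 * v.2 - u.2 * v.1| := by
    rw [← abs_neg]; congr 1; ring
  simp only [hD] at h
  rw [← h]
  refine measure_mono ?_
  rintro x ⟨⟨-, h1⟩, -, h2⟩
  refine ⟨?_, ?_⟩
  · convert h1 using 2; ring
  · convert h2 using 2; ring

lemma volume_dirRect_inter_le_of_cos {v u : ℝ × ℝ} (c d : ℝ × ℝ) {l L m M : ℝ} (hL : 0 ≤ L)
    (hs : u.1 * v.1 + u.2 * v.2 ≠ 0) :
    volume (dirRect v c l L ∩ dirRect u d m M) ≤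
      ENNReal.ofReal (L * m / |u.1 * v.1 + u.2 * v.2|) := by
  have h := volume_strip_inter_strip v (-u.2, u.1) (v.1 * c.1 + v.2 * c.2)
    (-u.2 * d.1 + u.1 * d.2) L m
    (by simp only; intro h; apply hs; linarith) hL
  have hD : |v.1 * u.1 - v.2 * -u.2| = |u.1 * v.1 + u.2 * v.2| := by
    congr 1; ring
  simp only [hD] at h
  rw [← h]
  refine measure_mono ?_
  rintro x ⟨⟨h1, -⟩, -, h2⟩
  refine ⟨?_, ?_⟩
  · convert h1 using 2; ring
  · convert h2 using 2; ring

/-- Two rectangles whose directions make an angle of sine comparable to `σ` overlap in a set of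
relative size at most `min (m, ρ) / ρ`, up to a constant, where `ρ = max (l, L σ)`. -/
lemma volume_dirRect_inter_le {v u : ℝ × ℝ} (hv : v.1 ^ 2 + v.2 ^ 2 = 1)
    (hu : u.1 ^ 2 + u.2 ^ 2 = 1) (c d : ℝ × ℝ) {l L m M σ : ℝ} (hl : 0 < l) (hlL : l ≤ L)
    (hm : 0 < m) (hσ : 0 ≤ σ) (hσ1 : σ ≤ |u.1 * v.2 - u.2 * v.1|) :
    volume (dirRect v c l L ∩ dirRect u d m M) ≤
      ENNReal.ofReal (2 * (l * L) * min m (max l (L * σ)) / max l (L * σ)) := by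
  have hL : 0 < L := hl.trans_le hlL
  set ρ := max l (L * σ) with hρ
  have hρ0 : 0 < ρ := lt_max_of_lt_left hl
  have hid : |u.1 * v.1 + u.2 * v.2| ^ 2 + |u.1 * v.2 - u.2 * v.1| ^ 2 = 1 := by
    rw [sq_abs, sq_abs]
    linear_combination (v.1 ^ 2 + v.2 ^ 2) * hu + hv
  set cs := |u.1 * v.1 + u.2 * v.2| with hcs
  set sn := |u.1 * v.2 - u.2 * v.1| with hsn
  have hcs0 : 0 ≤ cs := abs_nonneg _
  have hsn0 : 0 ≤ sn := abs_nonneg _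
  rcases le_total m ρ with hmρ | hmρ
  · rw [min_eq_left hmρ]
    have hsin : 0 < sn → l * m / sn ≤ 2 * (l * L) * m / ρ →
        volume (dirRect v c l L ∩ dirRect u d m M) ≤ ENNReal.ofReal (2 * (l * L) * m / ρ) :=
      fun h0 h => (volume_dirRect_inter_le_of_sin c d hl.le (abs_pos.1 h0)).trans
        (ENNReal.ofReal_le_ofReal h)
    rcases le_total l (L * σ) with h | h
    · have hρ' : ρ = L * σ := max_eq_right h
      have hσ0 : 0 < σ := by
        by_contra hc
        have : σ = 0 := le_antisymm (not_lt.1 hc) hσ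
        rw [this] at h; linarith
      refine hsin (hσ0.trans_le hσ1) ?_
      rw [hρ', div_le_div_iff₀ (hσ0.trans_le hσ1) (by positivity)]
      have h1 : l * m * L * σ ≤ l * m * L * sn := by gcongr
      have h2 : 0 ≤ l * m * L * sn := by positivity
      nlinarith
    · have hρ' : ρ = l := max_eq_left h
      rcases le_total (1 / 2) cs with h2 | h2
      · refine (volume_dirRect_inter_le_of_cos c d hL.le (abs_pos.1 (by linarith))).trans
          (ENNReal.ofReal_le_ofReal ?_)
        rw [hρ', div_le_div_iff₀ (by linarith) hl]
        have : L * m * l * (1 / 2) ≤ L * m * l * cs := by gcongr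
        nlinarith
      · have h3 : 1 / 2 ≤ sn := by nlinarith
        refine hsin (by linarith) ?_
        rw [hρ', div_le_div_iff₀ (by linarith) hl]
        have : l * m * L * (1 / 2) ≤ l * m * L * sn := by gcongr
        have : l * m * l ≤ l * m * L := by gcongr
        nlinarith
  · rw [min_eq_right hmρ, mul_div_cancel_right₀ _ hρ0.ne']
    refine (measure_mono inter_subset_left).trans ?_
    rw [volume_dirRect hv c hL.le]
    exact ENNReal.ofReal_le_ofReal (by nlinarith [mul_pos hl hL])

/-- If `dirRect v c l L` meets a longer rectangle whose direction makes an angle of sine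
comparable to `σ`, then the dilated longer rectangle fills a large part of each square of
half-side `5 ρ`, `ρ = max (l, L σ)`, centered in `dirRect v c l L`. -/
lemma le_volume_closedBall_inter_dirRect {v u : ℝ × ℝ} (hv : v.1 ^ 2 + v.2 ^ 2 = 1)
    (hu : u.1 ^ 2 + u.2 ^ 2 = 1) {c d x : ℝ × ℝ} {l L m M σ : ℝ} (hl : 0 < l) (hlL : l ≤ L)
    (hm : 0 < m) (hLM : L ≤ M) (hσ1 : σ ≤ |u.1 * v.2 - u.2 * v.1|)
    (hσ2 : |u.1 * v.2 - u.2 * v.1| ≤ 2 * σ) (hx : x ∈ dirRect v c l L)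
    (hne : (dirRect v c l L ∩ dirRect u d m M).Nonempty) :
    ENNReal.ofReal (min m (max l (L * σ)) * max l (L * σ)) ≤
      volume (dirRect u d (6 * m) (6 * M) ∩ Metric.closedBall x (5 * max l (L * σ))) := by
  obtain ⟨z, ⟨hz1, hz2⟩, hz3, hz4⟩ := hne
  obtain ⟨hx1, hx2⟩ := hx
  have hL : 0 < L := hl.trans_le hlL
  set ρ := max l (L * σ) with hρ
  have hρ0 : 0 < ρ := lt_max_of_lt_left hl
  have hlρ : l ≤ ρ := le_max_left _ _
  have hσρ : L * σ ≤ ρ := le_max_right _ _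
  have hid : (u.1 * v.1 + u.2 * v.2) ^ 2 + (u.1 * v.2 - u.2 * v.1) ^ 2 = 1 := by
    linear_combination (v.1 ^ 2 + v.2 ^ 2) * hu + hv
  have hcs1 : |u.1 * v.1 + u.2 * v.2| ≤ 1 := abs_le_one_of_sq_add_sq hid
  have hsn1 : |u.1 * v.2 - u.2 * v.1| ≤ 1 :=
    abs_le_one_of_sq_add_sq (by rwa [add_comm])
  have hρL : ρ ≤ L := max_le hlL (by nlinarith only [hL, hσ1, hsn1])
  set a := (x.1 - z.1) * v.1 + (x.2 - z.2) * v.2 with ha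
  set b := (x.2 - z.2) * v.1 - (x.1 - z.1) * v.2 with hb
  have ha' : |a| ≤ L := by
    rw [show a = ((x.1 - c.1) * v.1 + (x.2 - c.2) * v.2) -
      ((z.1 - c.1) * v.1 + (z.2 - c.2) * v.2) by rw [ha]; ring]
    exact (abs_sub _ _).trans (by linarith only [hx1, hz1])
  have hb' : |b| ≤ l := by
    rw [show b = ((x.2 - c.2) * v.1 - (x.1 - c.1) * v.2) -
      ((z.2 - c.2) * v.1 - (z.1 - c.1) * v.2) by rw [hb]; ring]
    exact (abs_sub _ _).trans (by linarith only [hx2, hz2])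
  set a' := (x.1 - z.1) * u.1 + (x.2 - z.2) * u.2 with ha2
  set b' := (x.2 - z.2) * u.1 - (x.1 - z.1) * u.2 with hb2
  have e1 : a' = a * (u.1 * v.1 + u.2 * v.2) - b * (u.1 * v.2 - u.2 * v.1) := by
    rw [ha, hb, ha2]
    linear_combination (-(x.1 - z.1) * u.1 - (x.2 - z.2) * u.2) * hv
  have e2 : b' = a * (u.1 * v.2 - u.2 * v.1) + b * (u.1 * v.1 + u.2 * v.2) := by
    rw [ha, hb, hb2]
    linear_combination (-(x.2 - z.2) * u.1 + (x.1 - z.1) * u.2) * hv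
  have ha3 : |a'| ≤ 2 * L := by
    rw [e1]
    refine (abs_sub _ _).trans ?_
    rw [abs_mul, abs_mul]
    have h1 := mul_le_mul ha' hcs1 (abs_nonneg _) hL.le
    have h2 := mul_le_mul hb' hsn1 (abs_nonneg _) hl.le
    linarith only [h1, h2, hlL]
  have hb3 : |b'| ≤ 3 * ρ := by
    rw [e2]
    refine (abs_add_le _ _).trans ?_
    rw [abs_mul, abs_mul]
    have h1 := mul_le_mul ha' hσ2 (abs_nonneg _) hL.le
    have h2 := mul_le_mul hb' hcs1 (abs_nonneg _) hl.le
    linarith only [h1, h2, hlρ, hσρ]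
  have hu1 : |u.1| ≤ 1 := abs_le_one_of_sq_add_sq hu
  have hu2 : |u.2| ≤ 1 := abs_le_one_of_sq_add_sq (by rwa [add_comm])
  rw [← volume_dirRect hu (z.1 + a' * u.1, z.2 + a' * u.2) hρ0.le]
  refine measure_mono ?_
  rintro y ⟨hy1, hy2⟩
  simp only at hy1 hy2
  set p := (y.1 - (z.1 + a' * u.1)) * u.1 + (y.2 - (z.2 + a' * u.2)) * u.2 with hp
  set q := (y.2 - (z.2 + a' * u.2)) * u.1 - (y.1 - (z.1 + a' * u.1)) * u.2 with hq
  have hqm : |q| < m / 2 := hy2.trans_le (by have := min_le_left m ρ; linarith only [this])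
  have hqρ : |q| < ρ / 2 := hy2.trans_le (by have := min_le_right m ρ; linarith only [this])
  refine ⟨⟨?_, ?_⟩, ?_⟩
  · rw [show (y.1 - d.1) * u.1 + (y.2 - d.2) * u.2 =
      p + ((z.1 - d.1) * u.1 + (z.2 - d.2) * u.2) + a' by
        rw [hp]; linear_combination a' * hu]
    refine (abs_add_three _ _ _).trans_lt ?_
    linarith only [hy1, hz3, ha3, hρL, hLM, hL]
  · rw [show (y.2 - d.2) * u.1 - (y.1 - d.1) * u.2 =
      q + ((z.2 - d.2) * u.1 - (z.1 - d.1) * u.2) by rw [hq]; ring]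
    refine (abs_add_le _ _).trans_lt ?_
    linarith only [hqm, hz4, hm]
  · have key : ∀ r s : ℝ, |r| ≤ 1 → |s| ≤ 1 → |p * r + (q - b') * s| ≤ 5 * ρ := by
      intro r s hr hs
      refine (abs_add_le _ _).trans ?_
      rw [abs_mul, abs_mul]
      have h1 : |q - b'| ≤ 4 * ρ := (abs_sub _ _).trans (by linarith only [hqρ, hb3, hρ0])
      have h2 := mul_le_mul hy1.le hr (abs_nonneg _) (by linarith only [hρ0])
      have h3 := mul_le_mul h1 hs (abs_nonneg _) (by linarith only [hρ0])
      linarith only [h2, h3, hρ0]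
    rw [Metric.mem_closedBall, Prod.dist_eq, Real.dist_eq, Real.dist_eq]
    refine max_le ?_ ?_
    · rw [show y.1 - x.1 = p * u.1 + (q - b') * (-u.2) by
        rw [hp, hq, hb2, ha2]; linear_combination
          (x.1 - y.1 + ((x.1 - z.1) * u.1 + (x.2 - z.2) * u.2) * u.1) * hu]
      exact key _ _ hu1 (by rwa [abs_neg])
    · rw [show y.2 - x.2 = p * u.2 + (q - b') * u.1 by
        rw [hp, hq, hb2, ha2]; linear_combination
          (x.2 - y.2 + ((x.1 - z.1) * u.1 + (x.2 - z.2) * u.2) * u.2) * hu]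
      exact key _ _ hu2 hu1

lemma sq_add_sq_of_mem_SigmaN {N : ℕ} {v : ℝ × ℝ} (hv : v ∈ SigmaN N) :
    v.1 ^ 2 + v.2 ^ 2 = 1 := by
  obtain ⟨j, -, rfl⟩ := hv
  exact Real.cos_sq_add_sin_sq _

lemma abs_sin_int_mul_pi_div (N : ℕ) (hN : 0 < N) (k : ℤ) :
    Real.sin (k * π / N) = 0 ∨ 1 / (N : ℝ) ≤ |Real.sin (k * π / N)| := by
  have hN' : (0 : ℝ) < N := by exact_mod_cast hN
  have hNz : (0 : ℤ) < N := by exact_mod_cast hN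
  have hbase : ∀ r : ℝ, 1 ≤ r → r ≤ N / 2 → 1 / (N : ℝ) ≤ Real.sin (r * π / N) := by
    intro r h1 h2
    have h3 : r * π / N ≤ π / 2 := by
      rw [div_le_div_iff₀ hN' two_pos]
      nlinarith [Real.pi_pos]
    refine le_trans ?_ (Real.mul_le_sin (by positivity) h3)
    rw [show 2 / π * (r * π / N) = 2 * r / N by field_simp]
    gcongr
    linarith
  have hdiv : (k : ℝ) * π / N = ((k % N : ℤ) : ℝ) * π / N + (k / N : ℤ) * π := by
    have : (k : ℝ) = ((k % N : ℤ) : ℝ) + (N : ℝ) * (k / N : ℤ) := by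
      exact_mod_cast (Int.emod_add_mul_ediv k N).symm
    rw [this]
    field_simp
  have habs : |Real.sin (k * π / N)| = |Real.sin (((k % N : ℤ) : ℝ) * π / N)| := by
    rw [hdiv, Real.sin_add_int_mul_pi, abs_mul, abs_zpow, abs_neg, abs_one, one_zpow, one_mul]
  rcases (Int.emod_nonneg k hNz.ne').eq_or_lt with h | h
  · left
    rw [← abs_eq_zero, habs, ← h]
    simp
  · right
    rw [habs]
    have h1 : (1 : ℝ) ≤ ((k % N : ℤ) : ℝ) := by exact_mod_cast h
    have h2 : ((k % N : ℤ) : ℝ) ≤ N - 1 := by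
      have : k % N + 1 ≤ N := Int.emod_lt_of_pos k hNz
      have : ((k % N : ℤ) : ℝ) + 1 ≤ N := by exact_mod_cast this
      linarith
    rcases le_total ((k % N : ℤ) : ℝ) (N / 2) with h3 | h3
    · exact (hbase _ h1 h3).trans (le_abs_self _)
    · have := hbase (N - ((k % N : ℤ) : ℝ)) (by linarith) (by linarith)
      rw [show (N - ((k % N : ℤ) : ℝ)) * π / N = π - ((k % N : ℤ) : ℝ) * π / N by
        field_simp, Real.sin_pi_sub] at this
      exact this.trans (le_abs_self _)

lemma cross_eq_zero_or_le {N : ℕ} (hN : 0 < N) {v u : ℝ × ℝ} (hv : v ∈ SigmaN N)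
    (hu : u ∈ SigmaN N) :
    u.1 * v.2 - u.2 * v.1 = 0 ∨ 1 / (N : ℝ) ≤ |u.1 * v.2 - u.2 * v.1| := by
  obtain ⟨j, -, rfl⟩ := hv
  obtain ⟨k, -, rfl⟩ := hu
  have h := abs_sin_int_mul_pi_div N hN (2 * j - 2 * k)
  have e : (((2 * j - 2 * k : ℤ) : ℝ)) * π / N = 2 * π * j / N - 2 * π * k / N := by
    push_cast; ring
  rw [e, Real.sin_sub] at h
  simp only
  rwa [show Real.cos (2 * π * k / N) * Real.sin (2 * π * j / N) -
    Real.sin (2 * π * k / N) * Real.cos (2 * π * j / N) =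
    Real.sin (2 * π * j / N) * Real.cos (2 * π * k / N) -
    Real.cos (2 * π * j / N) * Real.sin (2 * π * k / N) by ring]

/-- Representatives of the dyadic classes of sines of angles between directions of `Σ_N`. -/
def angleScale (N : ℕ) : ℕ → ℝ
  | 0 => 0
  | k + 1 => 2 ^ k / N

lemma angleScale_nonneg (N κ : ℕ) : 0 ≤ angleScale N κ := by
  cases κ with
  | zero => exact le_rfl
  | succ k => unfold angleScale; positivity

lemma exists_angleScale {N : ℕ} (hN : 0 < N) {v u : ℝ × ℝ} (hv : v ∈ SigmaN N)
    (hu : u ∈ SigmaN N) :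
    ∃ κ ∈ Finset.range (Nat.log 2 N + 2), angleScale N κ ≤ |u.1 * v.2 - u.2 * v.1| ∧
      |u.1 * v.2 - u.2 * v.1| ≤ 2 * angleScale N κ := by
  have hN' : (0 : ℝ) < N := by exact_mod_cast hN
  have hs1 : |u.1 * v.2 - u.2 * v.1| ≤ 1 := by
    have hv' := sq_add_sq_of_mem_SigmaN hv
    have hu' := sq_add_sq_of_mem_SigmaN hu
    refine abs_le_one_of_sq_add_sq (b := u.1 * v.1 + u.2 * v.2) ?_
    linear_combination (v.1 ^ 2 + v.2 ^ 2) * hu' + hv'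
  rcases cross_eq_zero_or_le hN hv hu with h | h
  · exact ⟨0, by simp, by simp [angleScale, h], by simp [angleScale, h]⟩
  · set s := |u.1 * v.2 - u.2 * v.1|
    have h1 : 1 ≤ s * N := by rwa [div_le_iff₀ hN'] at h
    have hf1 : 1 ≤ ⌊s * N⌋₊ := Nat.le_floor (by simpa using h1)
    refine ⟨Nat.log 2 ⌊s * N⌋₊ + 1, ?_, ?_, ?_⟩
    · have : ⌊s * N⌋₊ ≤ N := Nat.floor_le_of_le (by nlinarith)
      have := Nat.log_mono_right (b := 2) this
      rw [Finset.mem_range]; omega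
    · rw [angleScale, div_le_iff₀ hN']
      refine le_trans ?_ (Nat.floor_le (by positivity))
      exact_mod_cast Nat.pow_log_le_self 2 (by omega)
    · rw [angleScale, ← mul_div_assoc, le_div_iff₀ hN']
      refine (Nat.lt_floor_add_one _).le.trans ?_
      have : ⌊s * N⌋₊ + 1 ≤ 2 ^ (Nat.log 2 ⌊s * N⌋₊ + 1) :=
        Nat.lt_pow_succ_log_self (by norm_num) _
      calc ((⌊s * N⌋₊ : ℝ) + 1) ≤ 2 ^ (Nat.log 2 ⌊s * N⌋₊ + 1) := by exact_mod_cast this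
        _ = _ := by ring

lemma lowerSemicontinuous_iSup_isOpen {X : Type*} [TopologicalSpace X] (P : Set X → Prop)
    (hP : ∀ R, P R → IsOpen R) (a : Set X → ℝ≥0∞) :
    LowerSemicontinuous fun x => ⨆ (R : Set X) (_ : P R ∧ x ∈ R), a R := by
  rw [lowerSemicontinuous_iff_isOpen_preimage]
  intro y
  have : (fun x => ⨆ (R : Set X) (_ : P R ∧ x ∈ R), a R) ⁻¹' Ioi y =
      ⋃ (R : Set X) (_ : P R ∧ y < a R), R := by
    ext x
    simp only [mem_preimage, mem_Ioi, lt_iSup_iff, mem_iUnion, exists_prop]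
    exact ⟨fun ⟨R, h1, h2⟩ => ⟨R, ⟨h1.1, h2⟩, h1.2⟩, fun ⟨R, h1, h2⟩ => ⟨R, ⟨h1.1, h2⟩, h1.2⟩⟩
  rw [this]
  exact isOpen_biUnion fun R hR => hP R hR.1

lemma measurable_MHL2 (w : ℝ × ℝ → ℝ) : Measurable (MHL2 w) :=
  (lowerSemicontinuous_iSup_isOpen IsCube2
    (by rintro R ⟨a, b, r, -, rfl⟩; exact isOpen_Ioo.prod isOpen_Ioo) _).measurable

lemma IsDirRect.isOpen {N : ℕ} {R : Set (ℝ × ℝ)} (hR : IsDirRect N R) : IsOpen R := by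
  obtain ⟨v, -, c, l, L, -, -, rfl⟩ := hR
  exact isOpen_dirRect v c l L

lemma measurable_MSigE (N : ℕ) (g : ℝ × ℝ → ℝ≥0∞) : Measurable (MSigE N g) :=
  (lowerSemicontinuous_iSup_isOpen (IsDirRect N) (fun _ h => h.isOpen) _).measurable

/-- The Fefferman–Stein inequality for the Hardy–Littlewood maximal operator over squares. -/
lemma lintegral_le_of_forall_exists_closedBall (w : ℝ × ℝ → ℝ) {F : ℝ × ℝ → ℝ≥0∞}
    (hF : Measurable F) {E : Set (ℝ × ℝ)} {r : ℝ × ℝ → ℝ} {B : ℝ} {a : ℝ≥0∞}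
    (hr : ∀ x ∈ E, 0 < r x) (hB : ∀ x ∈ E, r x ≤ B)
    (hE : ∀ x ∈ E, volume (Metric.closedBall x (r x)) ≤
      a * ∫⁻ y in Metric.closedBall x (r x), F y) :
    ∫⁻ x in E, ENNReal.ofReal |w x| ≤ 36 * a * ∫⁻ x, F x * MHL2 w x := by
  obtain ⟨u, huE, hdisj, hcov⟩ := Vitali.exists_disjoint_subfamily_covering_enlargement_closedBall
    E id r B hB 5 (by norm_num)
  simp only [id] at hdisj hcov
  have hucount : u.Countable := hdisj.countable_of_nonempty_interior fun x hx =>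
    ⟨x, Metric.ball_subset_interior_closedBall (Metric.mem_ball_self (hr x (huE hx)))⟩
  have : Countable u := hucount.to_subtype
  have hsub : E ⊆ ⋃ x : u, Metric.closedBall (x : ℝ × ℝ) (5 * r x) := by
    intro x hx
    obtain ⟨b, hb, hxb⟩ := hcov x hx
    exact mem_iUnion.2 ⟨⟨b, hb⟩, hxb (Metric.mem_closedBall_self (hr x hx).le)⟩
  have hone : ∀ x : u, ∫⁻ y in Metric.closedBall (x : ℝ × ℝ) (5 * r x), ENNReal.ofReal |w y| ≤
      36 * a * ∫⁻ y in Metric.closedBall (x : ℝ × ℝ) (r x), F y * MHL2 w y := by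
    rintro ⟨x, hx⟩
    have hrx := hr x (huE hx)
    simp only
    set Q := Ioo (x.1 - 6 * r x) (x.1 - 6 * r x + 12 * r x) ×ˢ
      Ioo (x.2 - 6 * r x) (x.2 - 6 * r x + 12 * r x) with hQ
    have hball : ∀ s, s ≤ 5 * r x → Metric.closedBall x s ⊆ Q := by
      intro s hs
      rw [← Prod.mk.eta (p := x), ← closedBall_prod_same, Real.closedBall_eq_Icc,
        Real.closedBall_eq_Icc]
      refine prod_mono (Icc_subset_Ioo ?_ ?_) (Icc_subset_Ioo ?_ ?_) <;> linarith
    have hcube : IsCube2 Q := ⟨_, _, 12 * r x, by linarith, rfl⟩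
    have hvolQ : volume Q = 36 * volume (Metric.closedBall x (r x)) := by
      rw [hQ, ← Prod.mk.eta (p := x), ← closedBall_prod_same, Measure.volume_eq_prod,
        Measure.prod_prod, Measure.prod_prod, Real.volume_Ioo, Real.volume_Ioo,
        Real.volume_closedBall, Real.volume_closedBall, ← ENNReal.ofReal_mul (by linarith),
        ← ENNReal.ofReal_mul (by linarith),
        show (36 : ℝ≥0∞) = ENNReal.ofReal 36 by simp, ← ENNReal.ofReal_mul (by norm_num)]
      congr 1
      simp only [Prod.mk.eta]
      ring
    have hQ0 : volume Q ≠ 0 := by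
      rw [hvolQ]
      exact mul_ne_zero (by norm_num) (Metric.measure_closedBall_pos volume x hrx).ne'
    have hQt : volume Q ≠ ⊤ := by
      rw [hvolQ]
      exact ENNReal.mul_ne_top (by norm_num) measure_closedBall_lt_top.ne
    set m := (∫⁻ y in Q, ENNReal.ofReal |w y|) / volume Q with hm
    have hmle : ∀ y ∈ Q, m ≤ MHL2 w y := fun y hy =>
      le_iSup₂_of_le (f := fun (Q : Set (ℝ × ℝ)) (_ : IsCube2 Q ∧ y ∈ Q) =>
        (∫⁻ y in Q, ENNReal.ofReal |w y|) / volume Q) Q ⟨hcube, hy⟩ le_rfl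
    calc ∫⁻ y in Metric.closedBall x (5 * r x), ENNReal.ofReal |w y|
        ≤ ∫⁻ y in Q, ENNReal.ofReal |w y| := lintegral_mono_set (hball _ le_rfl)
      _ = m * volume Q := (ENNReal.div_mul_cancel hQ0 hQt).symm
      _ = 36 * (volume (Metric.closedBall x (r x)) * m) := by rw [hvolQ]; ring
      _ ≤ 36 * ((a * ∫⁻ y in Metric.closedBall x (r x), F y) * m) := by
          gcongr; exact hE x (huE hx)
      _ = 36 * a * ∫⁻ y in Metric.closedBall x (r x), F y * m := by
          rw [lintegral_mul_const _ hF]; ring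
      _ ≤ _ := by
          gcongr 36 * a * ?_
          refine setLIntegral_mono' Metric.isClosed_closedBall.measurableSet fun y hy => ?_
          gcongr
          exact hmle y (hball _ (by linarith) hy)
  calc ∫⁻ x in E, ENNReal.ofReal |w x|
      ≤ ∫⁻ x in ⋃ x : u, Metric.closedBall (x : ℝ × ℝ) (5 * r x), ENNReal.ofReal |w x| :=
        lintegral_mono_set hsub
    _ ≤ ∑' x : u, ∫⁻ y in Metric.closedBall (x : ℝ × ℝ) (5 * r x), ENNReal.ofReal |w y| :=
        lintegral_iUnion_le _ _
    _ ≤ ∑' x : u, 36 * a * ∫⁻ y in Metric.closedBall (x : ℝ × ℝ) (r x), F y * MHL2 w y :=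
        ENNReal.tsum_le_tsum hone
    _ = 36 * a * ∫⁻ y in ⋃ x ∈ u, Metric.closedBall x (r x), F y * MHL2 w y := by
        rw [ENNReal.tsum_mul_left, lintegral_biUnion hucount
          (fun _ _ => Metric.isClosed_closedBall.measurableSet) hdisj]
    _ ≤ _ := mul_le_mul_right (setLIntegral_le_lintegral _ _) _

/-- A rectangle whose longest side is parallel to a direction in `Σ_N`. -/
structure OrientedRect (N : ℕ) where
  /-- direction of the longest side -/
  dir : ℝ × ℝ
  /-- center -/
  center : ℝ × ℝ
  /-- length of the shortest side -/
  short : ℝ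
  /-- length of the longest side -/
  long : ℝ
  dir_mem : dir ∈ SigmaN N
  short_pos : 0 < short
  short_le : short ≤ long

namespace OrientedRect

variable {N : ℕ} (R : OrientedRect N)

/-- The underlying set of an oriented rectangle. -/
def carrier : Set (ℝ × ℝ) := dirRect R.dir R.center R.short R.long

/-- The concentric dilate of an oriented rectangle by a factor of six. -/
def dilate : Set (ℝ × ℝ) := dirRect R.dir R.center (6 * R.short) (6 * R.long)

lemma long_pos : 0 < R.long := R.short_pos.trans_le R.short_le

lemma measurableSet_carrier : MeasurableSet R.carrier := (isOpen_dirRect _ _ _ _).measurableSet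

lemma measurableSet_dilate : MeasurableSet R.dilate := (isOpen_dirRect _ _ _ _).measurableSet

lemma volume_carrier : volume R.carrier = ENNReal.ofReal (R.short * R.long) :=
  volume_dirRect (sq_add_sq_of_mem_SigmaN R.dir_mem) _ R.long_pos.le

lemma volume_carrier_ne_zero : volume R.carrier ≠ 0 := by
  rw [R.volume_carrier]
  exact (ENNReal.ofReal_pos.2 (mul_pos R.short_pos R.long_pos)).ne'

lemma volume_carrier_ne_top : volume R.carrier ≠ ⊤ := by
  rw [R.volume_carrier]
  exact ENNReal.ofReal_ne_top

lemma volume_dilate : volume R.dilate = 36 * volume R.carrier := by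
  rw [R.volume_carrier, dilate, volume_dirRect (sq_add_sq_of_mem_SigmaN R.dir_mem) _
    (by linarith [R.long_pos]), show (36 : ℝ≥0∞) = ENNReal.ofReal 36 by simp,
    ← ENNReal.ofReal_mul (by norm_num)]
  congr 1
  ring

lemma carrier_subset_dilate : R.carrier ⊆ R.dilate := fun _ hx =>
  ⟨hx.1.trans (by linarith [R.long_pos]), hx.2.trans (by linarith [R.short_pos])⟩

lemma isDirRect_carrier : IsDirRect N R.carrier :=
  ⟨_, R.dir_mem, _, _, _, R.short_pos, R.short_le, rfl⟩

lemma isDirRect_dilate : IsDirRect N R.dilate :=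
  ⟨_, R.dir_mem, _, _, _, by linarith [R.short_pos], by linarith [R.short_le], rfl⟩

/-- The number of dilates from a finite family containing a point. -/
def dilateCount (S : Finset (OrientedRect N)) (x : ℝ × ℝ) : ℝ≥0∞ :=
  ∑ i ∈ S, i.dilate.indicator 1 x

lemma measurable_dilateCount (S : Finset (OrientedRect N)) : Measurable (dilateCount S) :=
  Finset.measurable_fun_sum _ fun i _ => measurable_one.indicator i.measurableSet_dilate

lemma setLIntegral_dilateCount (S : Finset (OrientedRect N)) (Q : Set (ℝ × ℝ)) :
    ∫⁻ x in Q, dilateCount S x = ∑ i ∈ S, volume (i.dilate ∩ Q) := by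
  unfold dilateCount
  rw [lintegral_finsetSum _ fun i _ => measurable_one.indicator i.measurableSet_dilate]
  refine Finset.sum_congr rfl fun i _ => ?_
  rw [lintegral_indicator_one i.measurableSet_dilate,
    Measure.restrict_apply i.measurableSet_dilate]

/-- If a rectangle is covered once, in the mean, by longer rectangles from a single angle class,
then their dilates have large density in a square around each of its points. -/
lemma volume_closedBall_le_of_class {S T : Finset (OrientedRect N)} (hTS : T ⊆ S)
    {σ : ℝ} (hσ : 0 ≤ σ) (hlong : ∀ i ∈ T, R.long ≤ i.long)
    (hσ1 : ∀ i ∈ T, σ ≤ |i.dir.1 * R.dir.2 - i.dir.2 * R.dir.1|)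
    (hσ2 : ∀ i ∈ T, |i.dir.1 * R.dir.2 - i.dir.2 * R.dir.1| ≤ 2 * σ)
    (hT : volume R.carrier ≤ ∑ i ∈ T, volume (i.carrier ∩ R.carrier)) {x : ℝ × ℝ}
    (hx : x ∈ R.carrier) :
    volume (Metric.closedBall x (5 * max R.short (R.long * σ))) ≤
      200 * ∫⁻ y in Metric.closedBall x (5 * max R.short (R.long * σ)), dilateCount S y := by
  have hl := R.short_pos
  have hL := R.long_pos
  have hv := sq_add_sq_of_mem_SigmaN R.dir_mem
  set ρ := max R.short (R.long * σ) with hρ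
  have hρ0 : 0 < ρ := lt_max_of_lt_left hl
  set Q := Metric.closedBall x (5 * ρ) with hQ
  have hterm : ∀ i ∈ T, volume (i.carrier ∩ R.carrier) ≤
      ENNReal.ofReal (2 * (R.short * R.long) / ρ ^ 2) * volume (i.dilate ∩ Q) := by
    intro i hi
    have hu := sq_add_sq_of_mem_SigmaN i.dir_mem
    rw [inter_comm]
    rcases (R.carrier ∩ i.carrier).eq_empty_or_nonempty with h | h
    · rw [h]; simp
    · refine (volume_dirRect_inter_le hv hu _ _ hl R.short_le i.short_pos hσ (hσ1 i hi)).trans ?_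
      refine le_trans (le_of_eq ?_) (mul_le_mul_right
        (le_volume_closedBall_inter_dirRect hv hu hl R.short_le i.short_pos (hlong i hi)
        (hσ1 i hi) (hσ2 i hi) hx h) _)
      rw [← ENNReal.ofReal_mul (by positivity)]
      congr 1
      rw [← hρ]
      field_simp
  have hsum : ENNReal.ofReal (R.short * R.long) ≤
      ENNReal.ofReal (2 * (R.short * R.long) / ρ ^ 2) * ∫⁻ y in Q, dilateCount S y := by
    rw [← R.volume_carrier, setLIntegral_dilateCount]
    refine hT.trans ((Finset.sum_le_sum hterm).trans ?_)
    rw [← Finset.mul_sum]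
    gcongr
  have hvolQ : volume Q = ENNReal.ofReal (100 * ρ ^ 2) := by
    rw [hQ, ← Prod.mk.eta (p := x), ← closedBall_prod_same, Measure.volume_eq_prod,
      Measure.prod_prod, Real.volume_closedBall, Real.volume_closedBall,
      ← ENNReal.ofReal_mul (by positivity)]
    congr 1
    ring
  calc volume Q = ENNReal.ofReal (100 * ρ ^ 2 / (R.short * R.long)) *
        ENNReal.ofReal (R.short * R.long) := by
        rw [hvolQ, ← ENNReal.ofReal_mul (by positivity)]
        congr 1
        field_simp
    _ ≤ ENNReal.ofReal (100 * ρ ^ 2 / (R.short * R.long)) *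
        (ENNReal.ofReal (2 * (R.short * R.long) / ρ ^ 2) * ∫⁻ y in Q, dilateCount S y) := by
        gcongr
    _ = 200 * ∫⁻ y in Q, dilateCount S y := by
        rw [← mul_assoc, ← ENNReal.ofReal_mul (by positivity),
          show (200 : ℝ≥0∞) = ENNReal.ofReal 200 by simp]
        congr 2
        field_simp
        norm_num

lemma exists_closedBall_of_mem {S : Finset (OrientedRect N)} (hR : R ∈ S) :
    ∃ r, 0 < r ∧ ∀ x ∈ R.carrier, volume (Metric.closedBall x r) ≤
      200 * ∫⁻ y in Metric.closedBall x r, dilateCount S y := by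
  have h0 : ∀ i ∈ ({R} : Finset (OrientedRect N)),
      |i.dir.1 * R.dir.2 - i.dir.2 * R.dir.1| = 0 := fun i hi => by
    rw [Finset.mem_singleton.1 hi, mul_comm, sub_self, abs_zero]
  refine ⟨5 * max R.short (R.long * 0), mul_pos (by norm_num) (lt_max_of_lt_left R.short_pos),
    fun x hx => R.volume_closedBall_le_of_class (T := {R}) (by simpa using hR) le_rfl
      (by simp) (fun i hi => (h0 i hi).ge) (fun i hi => (h0 i hi).le.trans (by simp)) (by simp) hx⟩

lemma exists_closedBall_of_overlap (hN : 0 < N) {S : Finset (OrientedRect N)}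
    (hR : ((Nat.log 2 N + 2 : ℕ) : ℝ≥0∞) * volume R.carrier <
      ∑ i ∈ S with R.long ≤ i.long, volume (i.carrier ∩ R.carrier)) :
    ∃ r, 0 < r ∧ ∀ x ∈ R.carrier, volume (Metric.closedBall x r) ≤
      200 * ∫⁻ y in Metric.closedBall x r, dilateCount S y := by
  choose κ hκ hκ1 hκ2 using fun i : OrientedRect N => exists_angleScale hN R.dir_mem i.dir_mem
  obtain ⟨k, -, hk⟩ : ∃ k ∈ Finset.range (Nat.log 2 N + 2), volume R.carrier ≤
      ∑ i ∈ {i ∈ S | R.long ≤ i.long} with κ i = k, volume (i.carrier ∩ R.carrier) := by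
    by_contra! hcon
    refine hR.not_ge ?_
    rw [← Finset.sum_fiberwise_of_maps_to (t := Finset.range (Nat.log 2 N + 2)) (g := κ)
      fun i _ => hκ i]
    refine (Finset.sum_le_sum fun k hk => (hcon k hk).le).trans ?_
    rw [Finset.sum_const, Finset.card_range, nsmul_eq_mul]
  refine ⟨5 * max R.short (R.long * angleScale N k),
    mul_pos (by norm_num) (lt_max_of_lt_left R.short_pos),
    fun x hx => R.volume_closedBall_le_of_class
      ((Finset.filter_subset _ _).trans (Finset.filter_subset _ _)) (angleScale_nonneg N k)
      ?_ ?_ ?_ hk hx⟩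
  · intro i hi
    simp only [Finset.mem_filter] at hi
    exact hi.1.2
  · intro i hi
    rw [← (Finset.mem_filter.1 hi).2]
    exact hκ1 i
  · intro i hi
    rw [← (Finset.mem_filter.1 hi).2]
    exact hκ2 i

open Classical in
/-- Greedy selection, in order of decreasing length, of rectangles that have small overlap with
the previously selected ones. -/
lemma exists_greedy_selection (s : Finset (OrientedRect N)) (K : ℝ≥0∞) {W : ℝ × ℝ → ℝ≥0∞}
    {A : OrientedRect N → ℝ≥0∞} (hA : ∀ R ∈ s, ∀ x ∈ R.carrier, A R ≤ W x) :
    ∃ S ⊆ s, (∀ R ∈ s, R ∉ S → K * volume R.carrier <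
        ∑ i ∈ S with R.long ≤ i.long, volume (i.carrier ∩ R.carrier)) ∧
      ∃ H : ℝ × ℝ → ℝ≥0∞, Measurable H ∧
        (∀ x, (∑ i ∈ S, i.carrier.indicator (fun _ => A i) x) ^ 2 ≤ W x * (2 * H x)) ∧
        ∫⁻ x, H x ≤ (K + 1) * ∑ i ∈ S, A i * volume i.carrier := by
  revert hA
  refine Finset.induction_on_min_value (fun R : OrientedRect N => R.long) s ?_ ?_
  · exact fun _ => ⟨∅, subset_rfl, by simp, 0, measurable_zero, by simp, by simp⟩
  · intro R s hRs hmin ih hA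
    obtain ⟨S, hSs, hS, H, hHm, hH, hHint⟩ := ih fun i hi => hA i (Finset.mem_insert_of_mem hi)
    have hfilter : S.filter (fun i => R.long ≤ i.long) = S :=
      Finset.filter_true_of_mem fun i hi => hmin i (hSs hi)
    by_cases hsel : K * volume R.carrier < ∑ i ∈ S, volume (i.carrier ∩ R.carrier)
    · refine ⟨S, hSs.trans (Finset.subset_insert _ _), ?_, H, hHm, hH, hHint⟩
      intro i hi hiS
      rcases Finset.mem_insert.1 hi with rfl | hi
      · rwa [hfilter]
      · exact hS i hi hiS
    · rw [not_lt] at hsel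
      have hRS : R ∉ S := fun h => hRs (hSs h)
      set g : ℝ × ℝ → ℝ≥0∞ := fun x => ∑ i ∈ S, (i.carrier ∩ R.carrier).indicator 1 x with hg
      have hgm : Measurable g := Finset.measurable_fun_sum _ fun i _ =>
        measurable_one.indicator (i.measurableSet_carrier.inter R.measurableSet_carrier)
      have hRm : Measurable (R.carrier.indicator (1 : ℝ × ℝ → ℝ≥0∞)) :=
        measurable_one.indicator R.measurableSet_carrier
      have hgint : ∫⁻ x, g x = ∑ i ∈ S, volume (i.carrier ∩ R.carrier) := by
        rw [hg, lintegral_finsetSum _ fun i _ =>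
          measurable_one.indicator (i.measurableSet_carrier.inter R.measurableSet_carrier)]
        refine Finset.sum_congr rfl fun i _ => ?_
        rw [lintegral_indicator_one (i.measurableSet_carrier.inter R.measurableSet_carrier)]
      have hgR : Measurable fun x => g x + R.carrier.indicator 1 x := hgm.add hRm
      refine ⟨insert R S, Finset.insert_subset_insert _ hSs, ?_,
        fun x => H x + A R * (g x + R.carrier.indicator 1 x),
        hHm.add (hgR.const_mul _), ?_, ?_⟩
      · intro i hi hiS
        rw [Finset.mem_insert, not_or] at hiS
        refine (hS i (Finset.mem_of_mem_insert_of_ne hi hiS.1) hiS.2).trans_le ?_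
        exact Finset.sum_le_sum_of_subset
          (Finset.filter_subset_filter _ (Finset.subset_insert _ _))
      · intro x
        beta_reduce
        rw [Finset.sum_insert hRS]
        by_cases hx : x ∈ R.carrier
        · have hsum : ∑ i ∈ S, i.carrier.indicator (fun _ => A i) x ≤ W x * g x := by
            rw [hg, Finset.mul_sum]
            refine Finset.sum_le_sum fun i hi => ?_
            by_cases hxi : x ∈ i.carrier
            · rw [indicator_of_mem hxi, indicator_of_mem (mem_inter hxi hx), Pi.one_apply, mul_one]
              exact hA i (Finset.mem_insert_of_mem (hSs hi)) x hxi
            · rw [indicator_of_notMem hxi]; exact zero_le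
          rw [indicator_of_mem hx, indicator_of_mem hx, Pi.one_apply]
          have hAR := hA R (Finset.mem_insert_self _ _) x hx
          set G := ∑ i ∈ S, i.carrier.indicator (fun _ => A i) x
          calc (A R + G) ^ 2 = G ^ 2 + 2 * A R * G + A R * A R := by ring
            _ ≤ W x * (2 * H x) + 2 * A R * (W x * g x) + W x * A R := by
                gcongr; exact hH x
            _ ≤ W x * (2 * H x) + 2 * A R * (W x * g x) + (W x * A R + W x * A R) := by
                gcongr; exact le_self_add
            _ = W x * (2 * (H x + A R * (g x + 1))) := by ring
        · rw [indicator_of_notMem hx, zero_add]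
          refine (hH x).trans ?_
          gcongr
          exact le_self_add
      · rw [lintegral_add_left hHm, lintegral_const_mul _ hgR, lintegral_add_left hgm,
          hgint, lintegral_indicator_one R.measurableSet_carrier, Finset.sum_insert hRS]
        calc _ ≤ (K + 1) * ∑ i ∈ S, A i * volume i.carrier +
              A R * (K * volume R.carrier + volume R.carrier) := by gcongr
          _ = _ := by ring

end OrientedRect

lemma sq_lintegral_le_of_sq_le {α : Type*} [MeasurableSpace α] {μ : Measure α}
    {h a b : α → ℝ≥0∞} (ha : AEMeasurable a μ) (hb : AEMeasurable b μ)
    (hab : ∀ x, h x ^ 2 ≤ a x * b x) :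
    (∫⁻ x, h x ∂μ) ^ 2 ≤ (∫⁻ x, a x ∂μ) * ∫⁻ x, b x ∂μ := by
  have hrt : ∀ y : ℝ≥0∞, (y ^ (1 / 2 : ℝ)) ^ (2 : ℝ) = y := fun y => by
    rw [← ENNReal.rpow_mul]; norm_num
  have hle : ∫⁻ x, h x ∂μ ≤
      (∫⁻ x, a x ∂μ) ^ (1 / 2 : ℝ) * (∫⁻ x, b x ∂μ) ^ (1 / 2 : ℝ) := by
    have hH := ENNReal.lintegral_mul_le_Lp_mul_Lq μ Real.HolderConjugate.two_two
      (ha.pow_const (1 / 2 : ℝ)) (hb.pow_const (1 / 2 : ℝ))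
    simp only [hrt] at hH
    refine le_trans (lintegral_mono fun x => ?_) hH
    rw [Pi.mul_apply, ← ENNReal.mul_rpow_of_nonneg _ _ (by norm_num)]
    calc h x = (h x ^ 2) ^ (1 / 2 : ℝ) := by
          rw [← ENNReal.rpow_natCast, ← ENNReal.rpow_mul]; norm_num
      _ ≤ _ := ENNReal.rpow_le_rpow (hab x) (by norm_num)
  calc (∫⁻ x, h x ∂μ) ^ 2
      ≤ ((∫⁻ x, a x ∂μ) ^ (1 / 2 : ℝ) * (∫⁻ x, b x ∂μ) ^ (1 / 2 : ℝ)) ^ 2 := by gcongr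
    _ = _ := by
        rw [← ENNReal.mul_rpow_of_nonneg _ _ (by norm_num), ← ENNReal.rpow_natCast]
        exact hrt _

open OrientedRect

/-- The weak type inequality for a finite family of rectangles. -/
lemma sq_mul_lintegral_biUnion_le {N : ℕ} (hN : 0 < N) {w f : ℝ × ℝ → ℝ}
    (hf : AEMeasurable f volume) {t : ℝ} (ht : 0 < t)
    (hfin : ∫⁻ x, ENNReal.ofReal (f x ^ 2) * MSigE N (MHL2 w) x ≠ ⊤)
    (s : Finset (OrientedRect N))
    (hs : ∀ R ∈ s, ENNReal.ofReal t * volume R.carrier ≤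
      ∫⁻ x in R.carrier, ENNReal.ofReal |f x|) :
    ENNReal.ofReal t ^ 2 * ∫⁻ x in ⋃ R ∈ s, R.carrier, ENNReal.ofReal |w x| ≤
      518400 * ((Nat.log 2 N + 2 : ℕ) + 1) *
        ∫⁻ x, ENNReal.ofReal (f x ^ 2) * MSigE N (MHL2 w) x := by
  set W := MSigE N (MHL2 w) with hW
  set K : ℝ≥0∞ := ((Nat.log 2 N + 2 : ℕ) : ℝ≥0∞) with hK
  set X := ∫⁻ x, ENNReal.ofReal (f x ^ 2) * W x with hX
  have hWm : Measurable W := measurable_MSigE _ _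
  have hμm : Measurable (MHL2 w) := measurable_MHL2 w
  have hf2 : AEMeasurable (fun x => ENNReal.ofReal (f x ^ 2)) volume := (hf.pow_const 2).ennreal_ofReal
  have hf1 : AEMeasurable (fun x => ENNReal.ofReal |f x|) volume := hf.abs.ennreal_ofReal
  set A : OrientedRect N → ℝ≥0∞ := fun R => (∫⁻ y in R.dilate, MHL2 w y) / volume R.dilate with hA
  have hAW : ∀ R ∈ s, ∀ x ∈ R.carrier, A R ≤ W x := fun R _ x hx =>
    le_iSup₂_of_le (f := fun (R : Set (ℝ × ℝ)) (_ : IsDirRect N R ∧ x ∈ R) =>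
      (∫⁻ y in R, MHL2 w y) / volume R) R.dilate
      ⟨R.isDirRect_dilate, R.carrier_subset_dilate hx⟩ le_rfl
  have hAfin : ∀ R ∈ s, A R ≠ ⊤ := by
    intro R hR htop
    have h1 : (∫⁻ x in R.carrier, ENNReal.ofReal (f x ^ 2)) * ⊤ ≤ X := by
      rw [← lintegral_mul_const'' _ hf2.restrict]
      refine le_trans ?_ (setLIntegral_le_lintegral R.carrier _)
      refine setLIntegral_mono' R.measurableSet_carrier fun x hx => ?_
      gcongr
      exact htop ▸ hAW R hR x hx
    have h2 : ∫⁻ x in R.carrier, ENNReal.ofReal (f x ^ 2) = 0 := by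
      by_contra h
      rw [ENNReal.mul_top h] at h1
      exact hfin (top_le_iff.1 h1)
    rw [lintegral_eq_zero_iff' hf2.restrict] at h2
    have h3 : ∫⁻ x in R.carrier, ENNReal.ofReal |f x| = 0 := by
      rw [lintegral_eq_zero_iff' hf1.restrict]
      filter_upwards [h2] with x hx
      simp only [Pi.zero_apply, ENNReal.ofReal_eq_zero] at hx ⊢
      have : f x = 0 := pow_eq_zero_iff two_ne_zero |>.1 (le_antisymm hx (sq_nonneg _))
      simp [this]
    have h4 := hs R hR
    rw [h3, nonpos_iff_eq_zero, mul_eq_zero] at h4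
    rcases h4 with h4 | h4
    · exact (ENNReal.ofReal_pos.2 ht).ne' h4
    · exact R.volume_carrier_ne_zero h4
  obtain ⟨S, hSs, hunsel, H, hHm, hH, hHint⟩ := exists_greedy_selection s K hAW
  set Y := ∑ i ∈ S, A i * volume i.carrier with hY
  have hYfin : Y ≠ ⊤ := ENNReal.sum_ne_top.2 fun i hi =>
    ENNReal.mul_ne_top (hAfin i (hSs hi)) i.volume_carrier_ne_top
  have hball : ∀ R ∈ s, ∃ r, 0 < r ∧ ∀ x ∈ R.carrier, volume (Metric.closedBall x r) ≤
      200 * ∫⁻ y in Metric.closedBall x r, dilateCount S y := by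
    intro R hR
    by_cases hRS : R ∈ S
    · exact R.exists_closedBall_of_mem hRS
    · exact R.exists_closedBall_of_overlap hN (hunsel R hR hRS)
  have hcover : ∫⁻ x in ⋃ R ∈ s, R.carrier, ENNReal.ofReal |w x| ≤ 259200 * Y := by
    rcases s.eq_empty_or_nonempty with rfl | ⟨R₀, -⟩
    · simp
    have : Nonempty (OrientedRect N) := ⟨R₀⟩
    choose! r hr0 hr using hball
    have hmem : ∀ x ∈ ⋃ R ∈ s, R.carrier, ∃ R ∈ s, x ∈ R.carrier := by
      intro x hx; simpa using hx
    choose! ρ hρs hρ using hmem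
    obtain ⟨B, hB⟩ := (s.image r).exists_le
    refine (lintegral_le_of_forall_exists_closedBall w (measurable_dilateCount S)
      (r := fun x => r (ρ x)) (B := B) (a := 200) (fun x hx => hr0 _ (hρs x hx))
      (fun x hx => hB _ (Finset.mem_image_of_mem _ (hρs x hx)))
      fun x hx => hr _ (hρs x hx) x (hρ x hx)).trans (le_of_eq ?_)
    have : ∫⁻ x, dilateCount S x * MHL2 w x = 36 * Y := by
      simp only [dilateCount, Finset.sum_mul]
      have hm : ∀ i ∈ S, Measurable fun x =>
          i.dilate.indicator (1 : ℝ × ℝ → ℝ≥0∞) x * MHL2 w x := fun i _ =>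
        (measurable_one.indicator i.measurableSet_dilate).mul hμm
      rw [lintegral_finsetSum _ hm, hY, Finset.mul_sum]
      refine Finset.sum_congr rfl fun i _ => ?_
      have h1 : ∀ x, i.dilate.indicator (1 : ℝ × ℝ → ℝ≥0∞) x * MHL2 w x =
          i.dilate.indicator (MHL2 w) x := fun x => by
        by_cases hx : x ∈ i.dilate <;> simp [hx]
      simp only [h1]
      rw [lintegral_indicator i.measurableSet_dilate, mul_left_comm, ← i.volume_dilate, hA,
        ENNReal.div_mul_cancel]
      · rw [i.volume_dilate]
        exact mul_ne_zero (by norm_num) i.volume_carrier_ne_zero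
      · rw [i.volume_dilate]
        exact ENNReal.mul_ne_top (by norm_num) i.volume_carrier_ne_top
    rw [this]
    ring
  have hdual : ENNReal.ofReal t * Y ≤
      ∫⁻ x, ENNReal.ofReal |f x| * ∑ i ∈ S, i.carrier.indicator (fun _ => A i) x := by
    simp only [Finset.mul_sum]
    have hm : ∀ i ∈ S, AEMeasurable fun x =>
        ENNReal.ofReal |f x| * i.carrier.indicator (fun _ => A i) x := fun i _ =>
      hf1.mul (measurable_const.indicator i.measurableSet_carrier).aemeasurable
    rw [lintegral_finsetSum' _ hm,
      hY, Finset.mul_sum]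
    refine Finset.sum_le_sum fun i hi => ?_
    have h1 : ∀ x, ENNReal.ofReal |f x| * i.carrier.indicator (fun _ => A i) x =
        i.carrier.indicator (fun x => A i * ENNReal.ofReal |f x|) x := fun x => by
      by_cases hx : x ∈ i.carrier <;> simp [hx, mul_comm]
    simp only [h1]
    rw [lintegral_indicator i.measurableSet_carrier, lintegral_const_mul'' _ hf1.restrict,
      mul_left_comm]
    gcongr
    exact hs i (hSs hi)
  have hCS : (ENNReal.ofReal t * Y) ^ 2 ≤ X * (2 * ((K + 1) * Y)) := by
    calc (ENNReal.ofReal t * Y) ^ 2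
        ≤ (∫⁻ x, ENNReal.ofReal |f x| * ∑ i ∈ S, i.carrier.indicator (fun _ => A i) x) ^ 2 := by
          gcongr
      _ ≤ X * ∫⁻ x, 2 * H x := by
          refine sq_lintegral_le_of_sq_le (hf2.mul hWm.aemeasurable)
            (hHm.const_mul 2).aemeasurable fun x => ?_
          rw [mul_pow, ← ENNReal.ofReal_pow (abs_nonneg _), sq_abs, mul_assoc]
          gcongr
          exact hH x
      _ ≤ _ := by
          rw [lintegral_const_mul _ hHm]
          gcongr
  have hmain : ENNReal.ofReal t ^ 2 * Y ≤ 2 * (K + 1) * X := by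
    rcases eq_or_ne Y 0 with h0 | h0
    · rw [h0, mul_zero]; exact zero_le
    · rw [← ENNReal.mul_le_mul_iff_left h0 hYfin]
      calc ENNReal.ofReal t ^ 2 * Y * Y = (ENNReal.ofReal t * Y) ^ 2 := by ring
        _ ≤ _ := hCS
        _ = _ := by ring
  calc ENNReal.ofReal t ^ 2 * ∫⁻ x in ⋃ R ∈ s, R.carrier, ENNReal.ofReal |w x|
      ≤ ENNReal.ofReal t ^ 2 * (259200 * Y) := by gcongr
    _ = 259200 * (ENNReal.ofReal t ^ 2 * Y) := by ring
    _ ≤ 259200 * (2 * (K + 1) * X) := by gcongr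
    _ = _ := by ring

lemma natLog_two_add_three_le {N : ℕ} (hN : 10 < N) :
    (((Nat.log 2 N + 2 : ℕ) : ℝ) + 1) ≤ 5 * Real.log N := by
  have hN' : (10 : ℝ) < N := by exact_mod_cast hN
  have h1 : 1 ≤ Real.log N := by
    rw [Real.le_log_iff_exp_le (by linarith)]
    linarith [Real.exp_one_lt_d9]
  have h2 := Real.natLog_le_logb N 2
  rw [Real.logb, Nat.cast_ofNat, le_div_iff₀ (Real.log_pos (by norm_num))] at h2
  have h3 := Real.log_two_gt_d9
  have h4 : (0 : ℝ) ≤ Nat.log 2 N := Nat.cast_nonneg _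
  push_cast
  nlinarith

/-- The weak type inequality, squared. -/
lemma sq_mul_setLIntegral_lt_MSig_le {N : ℕ} (hN : 0 < N) {w f : ℝ × ℝ → ℝ}
    (hf : AEMeasurable f volume) {t : ℝ} (ht : 0 < t)
    (hfin : ∫⁻ x, ENNReal.ofReal (f x ^ 2) * MSigE N (MHL2 w) x ≠ ⊤) :
    ENNReal.ofReal t ^ 2 * ∫⁻ x in {x | ENNReal.ofReal t < MSig N f x}, ENNReal.ofReal |w x| ≤
      518400 * ((Nat.log 2 N + 2 : ℕ) + 1) *
        ∫⁻ x, ENNReal.ofReal (f x ^ 2) * MSigE N (MHL2 w) x := by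
  set P : Set (OrientedRect N) := {R | ENNReal.ofReal t * volume R.carrier ≤
      ∫⁻ x in R.carrier, ENNReal.ofReal |f x|} with hP
  obtain ⟨T, hTP, hTc, hT⟩ := TopologicalSpace.isOpen_biUnion_countable P carrier
    fun R _ => R.isDirRect_carrier.isOpen
  have hsub : {x | ENNReal.ofReal t < MSig N f x} ⊆ ⋃ i : T, (i : OrientedRect N).carrier := by
    intro x hx
    rw [← biUnion_eq_iUnion T fun R _ => carrier R, hT]
    simp only [mem_ofPred_eq, MSig, lt_iSup_iff] at hx
    obtain ⟨_, ⟨⟨v, hv, c, l, L, hl, hL, rfl⟩, hxR⟩, hlt⟩ := hx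
    refine mem_biUnion (t := carrier) (x := ⟨v, c, l, L, hv, hl, hL⟩) ?_ hxR
    exact ENNReal.mul_le_of_le_div hlt.le
  have : Countable T := hTc.to_subtype
  have hdir : Directed (· ⊆ ·) fun F : Finset T => ⋃ i ∈ F, (i : OrientedRect N).carrier :=
    Monotone.directed_le fun F G hFG => biUnion_subset_biUnion_left hFG
  have hopen : ∀ i : T, IsOpen (i : OrientedRect N).carrier :=
    fun i => (i : OrientedRect N).isDirRect_carrier.isOpen
  set ν := (volume : Measure (ℝ × ℝ)).withDensity fun x => ENNReal.ofReal |w x| with hν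
  calc _ ≤ ENNReal.ofReal t ^ 2 * ν (⋃ i : T, (i : OrientedRect N).carrier) := by
        rw [hν, withDensity_apply _ (isOpen_iUnion hopen).measurableSet]
        gcongr
    _ = ⨆ F : Finset T, ENNReal.ofReal t ^ 2 * ν (⋃ i ∈ F, (i : OrientedRect N).carrier) := by
        rw [Set.iUnion_eq_iUnion_finset, hdir.measure_iUnion, ENNReal.mul_iSup]
    _ ≤ _ := by
        classical
        refine iSup_le fun F => ?_
        have hmeas : MeasurableSet (⋃ i ∈ F, (i : OrientedRect N).carrier) :=
          (isOpen_biUnion fun i _ => hopen i).measurableSet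
        rw [hν, withDensity_apply _ hmeas]
        have := sq_mul_lintegral_biUnion_le hN (w := w) hf ht hfin
          (F.image Subtype.val) (fun R hR => by
            obtain ⟨i, -, rfl⟩ := Finset.mem_image.1 hR
            exact hTP i.2)
        rwa [Finset.set_biUnion_finset_image] at this

/-- Weighted weak (2,2) bound for the directional maximal operator with `N`
uniformly spread directions, with majorant `W = M_{Σ_N} M_Q w`. -/
theorem directional_weak_22 :
    ∃ C : ℝ, 0 < C ∧
      ∀ N : ℕ, 10 < N →
        ∀ (w f : ℝ × ℝ → ℝ), (∀ x, 0 ≤ w x) → LocallyIntegrable w volume →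
          LocallyIntegrable f volume → ∀ t : ℝ, 0 < t →
            ENNReal.ofReal t *
                (∫⁻ x in {x | ENNReal.ofReal t < MSig N f x},
                  ENNReal.ofReal (w x)) ^ (1 / 2 : ℝ) ≤
              ENNReal.ofReal C * ENNReal.ofReal (Real.log N) ^ (1 / 2 : ℝ) *
                (∫⁻ x, ENNReal.ofReal (f x ^ 2) * MSigE N (MHL2 w) x) ^ (1 / 2 : ℝ) := by
  refine ⟨1610, by norm_num, fun N hN w f hw _ hf t ht => ?_⟩
  set X := ∫⁻ x, ENNReal.ofReal (f x ^ 2) * MSigE N (MHL2 w) x with hX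
  have hlog : 0 < Real.log N := Real.log_pos (by exact_mod_cast (by omega : 1 < N))
  have hl0 : ENNReal.ofReal (Real.log N) ≠ 0 := (ENNReal.ofReal_pos.2 hlog).ne'
  rcases eq_or_ne X ⊤ with htop | hfin
  · rw [htop, ENNReal.top_rpow_of_pos (by norm_num), ENNReal.mul_top]
    · exact le_top
    · refine mul_ne_zero (by simp) ?_
      rw [Ne, ENNReal.rpow_eq_zero_iff_of_pos (by norm_num)]
      exact hl0
  have hsq := sq_mul_setLIntegral_lt_MSig_le (by omega) (w := w)
    hf.aestronglyMeasurable.aemeasurable ht hfin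
  simp only [abs_of_nonneg (hw _)] at hsq
  have hroot : ∀ a : ℝ≥0∞, (a ^ 2) ^ (1 / 2 : ℝ) = a := fun a => by
    rw [← ENNReal.rpow_natCast, ← ENNReal.rpow_mul]; norm_num
  have hK : (518400 * (((Nat.log 2 N + 2 : ℕ) : ℝ≥0∞) + 1)) ≤
      ENNReal.ofReal 1610 ^ 2 * ENNReal.ofReal (Real.log N) := by
    rw [← ENNReal.ofReal_natCast, ← ENNReal.ofReal_one,
      show (518400 : ℝ≥0∞) = ENNReal.ofReal 518400 by simp,
      ← ENNReal.ofReal_add (by positivity) zero_le_one, ← ENNReal.ofReal_mul (by norm_num),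
      ← ENNReal.ofReal_pow (by norm_num), ← ENNReal.ofReal_mul (by norm_num)]
    refine ENNReal.ofReal_le_ofReal ?_
    have := natLog_two_add_three_le hN
    nlinarith
  have h := ENNReal.rpow_le_rpow (hsq.trans (mul_le_mul_left hK X))
    (by norm_num : (0 : ℝ) ≤ 1 / 2)
  rwa [ENNReal.mul_rpow_of_nonneg _ _ (by norm_num), ENNReal.mul_rpow_of_nonneg _ _ (by norm_num),
    ENNReal.mul_rpow_of_nonneg _ _ (by norm_num), hroot, hroot] at h
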